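/- There is no infinite run of the p-adic Jacobi–Perron algorithm such that 1, α_0^{(1)}, …, α_0^{(m)} are linearly dependent over ℚ and such that there exists n_0 with v_p(a_n^{(j)}) − v_p(a_n^{(1)}) ≥ j − 1 for all n ≥ n_0 and all j = 3, …, m+1 (here a_n^{(m+1)} = 1, v_p denotes the p-adic valuation on ℚ, with the convention v_p(0) = +∞). In other words, if the linear dependence and the eventual valuation condition hold, the algorithm stops in finitely many steps. -/

import Mathlib

open Finset Filter

/-- `q` belongs to `ℤ[1/p]`. -/
def InZInvP (p : ℕ) (q : ℚ) : Prop := ∃ (z : ℤ) (k : ℕ), q = (z : ℚ) / (p : ℚ) ^ k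

/-- `a` is the Browkin `s`-function value of `x`:
`a ∈ ℤ[1/p]`, `|a|_∞ < p/2` and `|x - a|_p < 1`. -/
def IsSValue (p : ℕ) [Fact p.Prime] (x : ℚ_[p]) (a : ℚ) : Prop :=
  InZInvP p a ∧ |a| < (p : ℚ) / 2 ∧ ‖x - (a : ℚ_[p])‖ < 1

/-- An infinite run of the `p`-adic Jacobi–Perron algorithm with complete quotients
`α n i` and partial quotients `a n i` (`n ≥ 0`, `i = 1,…,m`). -/
def JPRun (p : ℕ) [Fact p.Prime] (m : ℕ) (α : ℕ → ℕ → ℚ_[p]) (a : ℕ → ℕ → ℚ) : Prop :=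
  ∀ n : ℕ,
    (∀ i ∈ Finset.Icc 1 m, IsSValue p (α n i) (a n i)) ∧
    α n m ≠ ((a n m : ℚ) : ℚ_[p]) ∧
    α (n + 1) 1 = (α n m - ((a n m : ℚ) : ℚ_[p]))⁻¹ ∧
    ∀ i ∈ Finset.Icc 2 m,
      α (n + 1) i = (α n (i - 1) - ((a n (i - 1) : ℚ) : ℚ_[p])) / (α n m - ((a n m : ℚ) : ℚ_[p]))

/-- `A : ℤ → ℕ → ℚ` is the family of convergent numerators/denominators attached to the
partial quotients `a`: `A (-j) i = δ_{ij}` for `j = 1,…,m+1`, and for `n ≥ 0`,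
`A n i = Σ_{j=1}^m a n j * A (n-j) i + A (n-m-1) i`. -/
def JPConv (m : ℕ) (a : ℕ → ℕ → ℚ) (A : ℤ → ℕ → ℚ) : Prop :=
  (∀ i ∈ Finset.Icc 1 (m + 1), ∀ j ∈ Finset.Icc 1 (m + 1),
      A (-(j : ℤ)) i = if i = j then 1 else 0) ∧
  (∀ n : ℕ, ∀ i ∈ Finset.Icc 1 (m + 1),
      A n i = (∑ j ∈ Finset.Icc 1 m, a n j * A ((n : ℤ) - j) i) + A ((n : ℤ) - m - 1) i)


/-- The sequence of vectors `(S_{n-1}, …, S_{n-m-1})` attached to a linear relation `x`. -/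
def jpV (m : ℕ) (a : ℕ → ℕ → ℚ) (x : ℕ → ℚ) : ℕ → ℕ → ℚ
  | 0 => x
  | n + 1 => fun j => if j = 1 then (∑ i ∈ Finset.Icc 1 m, a n i * jpV m a x n i) + jpV m a x n (m + 1)
      else jpV m a x n (j - 1)

lemma jpV_one (m : ℕ) (a : ℕ → ℕ → ℚ) (x : ℕ → ℚ) (n : ℕ) :
    jpV m a x (n + 1) 1 = (∑ i ∈ Finset.Icc 1 m, a n i * jpV m a x n i) + jpV m a x n (m + 1) := by
  simp [jpV]

lemma jpV_succ (m : ℕ) (a : ℕ → ℕ → ℚ) (x : ℕ → ℚ) (n j : ℕ) (hj : 1 ≤ j) :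
    jpV m a x (n + 1) (j + 1) = jpV m a x n j := by
  have : j ≠ 0 := by omega
  simp [jpV, this]

lemma sum_Icc_shift {M : Type*} [AddCommMonoid M] (m : ℕ) (hm : 1 ≤ m) (f : ℕ → M) :
    ∑ i ∈ Finset.Icc 1 m, f i = f 1 + ∑ i ∈ Finset.Icc 2 m, f i := by
  have : Finset.Icc 1 m = insert 1 (Finset.Icc 2 m) := by
    ext i; simp; omega
  rw [this, Finset.sum_insert (by simp)]

lemma sum_Icc_two {M : Type*} [AddCommMonoid M] (m : ℕ) (f : ℕ → M) :
    ∑ i ∈ Finset.Icc 2 (m + 1), f i = ∑ i ∈ Finset.Icc 1 m, f (i + 1) := by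
  have : Finset.Icc 2 (m + 1) = (Finset.Icc 1 m).image (· + 1) := by
    simp
  rw [this, Finset.sum_image (by intro a _ b _ h; simpa using h)]

lemma inZ_add {p : ℕ} (hp : p ≠ 0) {a b : ℚ} (ha : InZInvP p a) (hb : InZInvP p b) :
    InZInvP p (a + b) := by
  obtain ⟨z, k, rfl⟩ := ha
  obtain ⟨w, l, rfl⟩ := hb
  refine ⟨z * p ^ l + w * p ^ k, k + l, ?_⟩
  have : (p : ℚ) ≠ 0 := by exact_mod_cast hp
  push_cast
  field_simp
  ring

lemma inZ_mul {p : ℕ} {a b : ℚ} (ha : InZInvP p a) (hb : InZInvP p b) :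
    InZInvP p (a * b) := by
  obtain ⟨z, k, rfl⟩ := ha
  obtain ⟨w, l, rfl⟩ := hb
  refine ⟨z * w, k + l, ?_⟩
  push_cast
  rw [pow_add, div_mul_div_comm]

lemma inZ_sum {p : ℕ} (hp : p ≠ 0) (s : Finset ℕ) (f : ℕ → ℚ) (h : ∀ i ∈ s, InZInvP p (f i)) :
    InZInvP p (∑ i ∈ s, f i) := by
  classical
  induction s using Finset.induction_on with
  | empty => exact ⟨0, 0, by simp⟩
  | insert i s hi ih =>
    rw [Finset.sum_insert hi]
    exact inZ_add hp (h i (by simp)) (ih fun j hj => h j (by simp [hj]))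

lemma inZ_bound {p : ℕ} [hp : Fact p.Prime] {q : ℚ} (hq : InZInvP p q) (h0 : q ≠ 0) :
    (1 : ℝ) ≤ |(q : ℝ)| * ‖(q : ℚ_[p])‖ := by
  obtain ⟨z, k, rfl⟩ := hq
  have hz : z ≠ 0 := by rintro rfl; simp at h0
  have hp0 : (0 : ℝ) < p := by exact_mod_cast hp.out.pos
  have h1 : (1 : ℝ) ≤ |(z : ℝ)| * ‖(z : ℚ_[p])‖ := by
    have h2 := (Padic.norm_int_le_pow_iff_dvd (p := p) z (padicValInt p z)).2
      (by simpa using padicValInt_dvd (p := p) z)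
    have h3 : ‖(z : ℚ_[p])‖ = (p : ℝ) ^ (-(padicValInt p z : ℤ)) := by
      have := Padic.eq_padicNorm (p := p) (z : ℚ)
      rw [Rat.cast_intCast] at this
      rw [this, padicNorm.eq_zpow_of_nonzero (by exact_mod_cast hz)]
      simp
    have h4 : (p : ℝ) ^ (padicValInt p z) ≤ |(z : ℝ)| := by
      have := Int.le_of_dvd (abs_pos.2 hz) ((dvd_abs _ _).2 (padicValInt_dvd (p := p) z))
      exact_mod_cast this
    rw [h3, zpow_neg, zpow_natCast, ← div_eq_mul_inv, one_le_div (by positivity)]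
    exact h4
  have h5 : ‖((((z : ℚ) / (p : ℚ) ^ k : ℚ)) : ℚ_[p])‖ = ‖(z : ℚ_[p])‖ * (p : ℝ) ^ k := by
    push_cast
    rw [norm_div, norm_pow, Padic.norm_p]
    simp
  rw [h5]
  push_cast
  rw [abs_div, abs_of_pos (show (0 : ℝ) < (p : ℝ) ^ k by positivity)]
  calc (1 : ℝ) ≤ _ := h1
    _ = _ := by field_simp

lemma norm_lt_one_le {p : ℕ} [hp : Fact p.Prime] {x : ℚ_[p]} (h : ‖x‖ < 1) :
    ‖x‖ * p ≤ 1 := by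
  have hp0 : (0 : ℝ) < p := by exact_mod_cast hp.out.pos
  have := (Padic.norm_le_pow_iff_norm_lt_pow_add_one x (-1)).2 (by simpa using h)
  rw [zpow_neg_one] at this
  calc ‖x‖ * p ≤ (p : ℝ)⁻¹ * p := by gcongr
    _ = 1 := by field_simp

lemma jpV_rel (p m : ℕ) [hp : Fact p.Prime] (hm : 1 ≤ m)
    (α : ℕ → ℕ → ℚ_[p]) (a : ℕ → ℕ → ℚ) (hrun : JPRun p m α a) (x : ℕ → ℚ)
    (hx : (∑ i ∈ Finset.Icc 1 m, ((x i : ℚ) : ℚ_[p]) * α 0 i) + ((x (m + 1) : ℚ) : ℚ_[p]) = 0)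
    (n : ℕ) :
    (∑ i ∈ Finset.Icc 1 m, ((jpV m a x n i : ℚ) : ℚ_[p]) * α n i)
      + ((jpV m a x n (m + 1) : ℚ) : ℚ_[p]) = 0 := by
  induction n with
  | zero => exact hx
  | succ n ih =>
    obtain ⟨m, rfl⟩ : ∃ k, m = k + 1 := ⟨m - 1, by omega⟩
    obtain ⟨-, h0, h1, h2⟩ := hrun n
    have hne : α n (m + 1) - ((a n (m + 1) : ℚ) : ℚ_[p]) ≠ 0 := sub_ne_zero.2 h0
    rw [sum_Icc_shift _ hm, sum_Icc_two, h1, jpV_one, jpV_succ _ _ _ _ _ hm]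
    have h3 : ∀ i ∈ Finset.Icc 1 m, ((jpV (m + 1) a x (n + 1) (i + 1) : ℚ) : ℚ_[p]) * α (n + 1) (i + 1)
        = (((jpV (m + 1) a x n i : ℚ) : ℚ_[p]) * (α n i - (a n i : ℚ_[p])))
          * (α n (m + 1) - ((a n (m + 1) : ℚ) : ℚ_[p]))⁻¹ := by
      intro i hi
      rw [Finset.mem_Icc] at hi
      rw [jpV_succ _ _ _ _ _ hi.1, h2 (i + 1) (by simp; omega)]
      simp [div_eq_mul_inv, mul_assoc]
    rw [Finset.sum_congr rfl h3, ← Finset.sum_mul]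
    rw [Finset.sum_Icc_succ_top (by omega)] at ih ⊢
    simp only [mul_sub, Finset.sum_sub_distrib]
    push_cast
    have h4 : ∑ i ∈ Finset.Icc 1 m, ((jpV (m + 1) a x n i : ℚ) : ℚ_[p]) * (a n i : ℚ_[p])
        = ∑ i ∈ Finset.Icc 1 m, (a n i : ℚ_[p]) * ((jpV (m + 1) a x n i : ℚ) : ℚ_[p]) :=
      Finset.sum_congr rfl fun i _ => mul_comm _ _
    rw [h4]
    field_simp
    linear_combination ih

/-- valuations of the complete quotients -/
lemma alpha_bound (p m : ℕ) [hp : Fact p.Prime] (hm : 1 ≤ m)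
    (α : ℕ → ℕ → ℚ_[p]) (a : ℕ → ℕ → ℚ) (hrun : JPRun p m α a) (n : ℕ)
    (hval : ∀ j ∈ Finset.Icc 3 (m + 1),
      padicNorm p (if j = m + 1 then 1 else a (n + 1) j) * (p : ℚ) ^ (j - 1)
        ≤ padicNorm p (a (n + 1) 1)) :
    1 < ‖α (n + 1) 1‖ ∧ (p : ℝ) ^ m ≤ ‖α (n + 1) 1‖ ∧
    ∀ j ∈ Finset.Icc 2 m, ‖α (n + 1) j‖ * (p : ℝ) ^ (j - 1) ≤ ‖α (n + 1) 1‖ := by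
  obtain ⟨hs, h0, h1, h2⟩ := hrun n
  obtain ⟨hs', -, -, -⟩ := hrun (n + 1)
  have hp0 : (0 : ℝ) < p := by exact_mod_cast hp.out.pos
  have hp1 : (1 : ℝ) < p := by exact_mod_cast hp.out.one_lt
  have hne : α n m - ((a n m : ℚ) : ℚ_[p]) ≠ 0 := sub_ne_zero.2 h0
  have hnp : 0 < ‖α n m - ((a n m : ℚ) : ℚ_[p])‖ := norm_pos_iff.2 hne
  have hlt : ‖α n m - ((a n m : ℚ) : ℚ_[p])‖ < 1 := (hs m (by simp; omega)).2.2
  have hα : (p : ℝ) ≤ ‖α (n + 1) 1‖ := by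
    rw [h1, norm_inv, ← one_div, le_div_iff₀ hnp, mul_comm]
    exact norm_lt_one_le hlt
  have ha1 : ‖((a (n + 1) 1 : ℚ) : ℚ_[p])‖ = ‖α (n + 1) 1‖ := by
    have h := (hs' 1 (by simp; omega)).2.2
    have h3 : ‖α (n + 1) 1 - ((a (n + 1) 1 : ℚ) : ℚ_[p])‖ < ‖α (n + 1) 1‖ := by linarith
    exact (Padic.norm_eq_of_norm_sub_lt_left h3).symm
  have hval' : ∀ j ∈ Finset.Icc 3 (m + 1),
      ‖(((if j = m + 1 then 1 else a (n + 1) j) : ℚ) : ℚ_[p])‖ * (p : ℝ) ^ (j - 1)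
        ≤ ‖α (n + 1) 1‖ := by
    intro j hj
    rw [← ha1, Padic.eq_padicNorm, Padic.eq_padicNorm]
    exact_mod_cast hval j hj
  have hpm : (p : ℝ) ^ m ≤ ‖α (n + 1) 1‖ := by
    rcases Nat.lt_or_ge m 2 with h | h
    · obtain rfl : m = 1 := by omega
      simpa using hα
    · simpa using hval' (m + 1) (by simp; omega)
  refine ⟨by linarith, hpm, ?_⟩
  intro j hj
  rw [Finset.mem_Icc] at hj
  rcases Nat.lt_or_ge j 3 with h | h
  · obtain rfl : j = 2 := by omega
    rw [h2 2 (by simp; omega), h1, norm_div, norm_inv, ← one_div, div_mul_eq_mul_div]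
    gcongr
    simpa using norm_lt_one_le (hs 1 (by simp; omega)).2.2
  · have h3 := hval' j (by simp; omega)
    rw [if_neg (by omega)] at h3
    have h4 := (hs' j (by simp; omega)).2.2
    have h5 : ‖α (n + 1) j‖ ≤ max ‖α (n + 1) j - (a (n + 1) j : ℚ_[p])‖ ‖(a (n + 1) j : ℚ_[p])‖ := by
      simpa using IsUltrametricDist.norm_add_le_max (α (n + 1) j - (a (n + 1) j : ℚ_[p])) (a (n + 1) j : ℚ_[p])
    rcases le_max_iff.1 h5 with h6 | h6
    · calc ‖α (n + 1) j‖ * (p : ℝ) ^ (j - 1) ≤ 1 * (p : ℝ) ^ m := by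
            gcongr
            · linarith
            · exact hp1.le
            · omega
        _ ≤ _ := by simpa using hpm
    · refine le_trans ?_ h3
      gcongr

lemma geom_q (r : ℝ) (hr : r ≠ 0) (m : ℕ) :
    (r - 1) * ∑ j ∈ Finset.Icc 1 m, (r⁻¹) ^ j = 1 - (r⁻¹) ^ m := by
  induction m with
  | zero => simp
  | succ m ih =>
    rw [Finset.sum_Icc_succ_top (by omega), mul_add, ih, pow_succ]
    field_simp
    ring

lemma exists_bound (s : Finset ℕ) (f : ℕ → ℝ) : ∃ C : ℝ, 0 < C ∧ ∀ j ∈ s, f j ≤ C := by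
  refine ⟨1 + ∑ j ∈ s, |f j|, by positivity, fun j hj => ?_⟩
  have := Finset.single_le_sum (f := fun j => |f j|) (fun i _ => abs_nonneg _) hj
  have := le_abs_self (f j)
  linarith

/-- There is no infinite run of the `p`-adic Jacobi–Perron algorithm such that
`1, α₀⁽¹⁾, …, α₀⁽ᵐ⁾` are `ℚ`-linearly dependent and eventually
`v_p(aₙ⁽ʲ⁾) - v_p(aₙ⁽¹⁾) ≥ j - 1` for `j = 3, …, m+1` (with `aₙ⁽ᵐ⁺¹⁾ = 1`);
the valuation condition is expressed multiplicatively via the `p`-adic norm,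
which incorporates the convention `v_p(0) = +∞`. -/
theorem jacobiPerron_finiteness (p m : ℕ) [hp : Fact p.Prime] (hp2 : 2 < p) (hm : 1 ≤ m)
    (α : ℕ → ℕ → ℚ_[p]) (a : ℕ → ℕ → ℚ)
    (hrun : JPRun p m α a)
    (hdep : ∃ x : ℕ → ℚ, (∃ i ∈ Finset.Icc 1 (m + 1), x i ≠ 0) ∧
      (∑ i ∈ Finset.Icc 1 m, ((x i : ℚ) : ℚ_[p]) * α 0 i) + ((x (m + 1) : ℚ) : ℚ_[p]) = 0)
    (hval : ∃ n₀ : ℕ, ∀ n ≥ n₀, ∀ j ∈ Finset.Icc 3 (m + 1),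
      padicNorm p (if j = m + 1 then 1 else a n j) * (p : ℚ) ^ (j - 1) ≤ padicNorm p (a n 1)) :
    False := by
  have hp0 : (0 : ℝ) < p := by exact_mod_cast hp.out.pos
  have hp2' : (2 : ℝ) < p := by exact_mod_cast hp2
  -- clear denominators
  obtain ⟨x, ⟨i₀, hi₀, hxi⟩, hx, hxint⟩ : ∃ x : ℕ → ℚ, (∃ i ∈ Finset.Icc 1 (m + 1), x i ≠ 0) ∧
      (∑ i ∈ Finset.Icc 1 m, ((x i : ℚ) : ℚ_[p]) * α 0 i) + ((x (m + 1) : ℚ) : ℚ_[p]) = 0 ∧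
      ∀ i ∈ Finset.Icc 1 (m + 1), InZInvP p (x i) := by
    obtain ⟨x, ⟨i₀, hi₀, hxi⟩, hx⟩ := hdep
    have hD : (∏ i ∈ Finset.Icc 1 (m + 1), ((x i).den : ℚ)) ≠ 0 :=
      Finset.prod_ne_zero_iff.2 fun i _ => by exact_mod_cast (x i).den_ne_zero
    refine ⟨fun i => (∏ i ∈ Finset.Icc 1 (m + 1), ((x i).den : ℚ)) * x i,
      ⟨i₀, hi₀, mul_ne_zero hD hxi⟩, ?_, ?_⟩
    · simp only [Rat.cast_mul, mul_assoc, ← Finset.mul_sum, ← mul_add]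
      rw [hx, mul_zero]
    · intro i hi
      refine ⟨(∏ i ∈ (Finset.Icc 1 (m + 1)).erase i, ((x i).den : ℤ)) * (x i).num, 0, ?_⟩
      rw [← Finset.mul_prod_erase _ _ hi]
      have := Rat.den_mul_eq_num (x i)
      push_cast
      rw [pow_zero, div_one, ← this]
      ring
  obtain ⟨n₀, hval⟩ := hval
  set V := jpV m a x with hV
  have hrel := jpV_rel p m hm α a hrun x hx
  rw [← hV] at hrel
  have hV1 : ∀ n, V (n + 1) 1 = (∑ i ∈ Finset.Icc 1 m, a n i * V n i) + V n (m + 1) := jpV_one m a x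
  have hVs : ∀ n j, 1 ≤ j → V (n + 1) (j + 1) = V n j := jpV_succ m a x
  -- integrality
  have hint : ∀ n, ∀ j ∈ Finset.Icc 1 (m + 1), InZInvP p (V n j) := by
    intro n
    induction n with
    | zero => exact hxint
    | succ n ih =>
      intro j hj
      rw [Finset.mem_Icc] at hj
      rcases Nat.lt_or_ge 1 j with h | h
      · obtain ⟨j, rfl⟩ : ∃ k, j = k + 1 := ⟨j - 1, by omega⟩
        rw [hVs _ _ (by omega)]
        exact ih j (by simp; omega)
      · obtain rfl : j = 1 := by omega
        rw [hV1]
        refine inZ_add hp.out.ne_zero (inZ_sum hp.out.ne_zero _ _ fun i hi => ?_) (ih _ (by simp))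
        refine inZ_mul ((hrun n).1 i hi).1 (ih i ?_)
        rw [Finset.mem_Icc] at *; omega
  -- archimedean bound
  obtain ⟨r, hr⟩ : ∃ r : ℝ, r = p / 2 + 1 := ⟨_, rfl⟩
  have hr0 : 0 < r := by rw [hr]; positivity
  have hr1 : 1 < r := by rw [hr]; linarith
  have hrp : r < p := by rw [hr]; linarith
  obtain ⟨B, hB0, hB⟩ := exists_bound (Finset.Icc 1 (m + 1)) (fun j => |(V 0 j : ℝ)| * r ^ j)
  have harch : ∀ n, ∀ j ∈ Finset.Icc 1 (m + 1), |(V n j : ℝ)| ≤ B * r ^ n * (r⁻¹) ^ j := by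
    intro n
    induction n with
    | zero =>
      intro j hj
      have := hB j hj
      rw [pow_zero, mul_one, inv_pow, ← div_eq_mul_inv, le_div_iff₀ (by positivity)]
      exact this
    | succ n ih =>
      intro j hj
      rw [Finset.mem_Icc] at hj
      rcases Nat.lt_or_ge 1 j with h | h
      · obtain ⟨j, rfl⟩ : ∃ k, j = k + 1 := ⟨j - 1, by omega⟩
        rw [hVs _ _ (by omega)]
        refine (ih j (by simp; omega)).trans (le_of_eq ?_)
        rw [pow_succ, pow_succ]; field_simp
      · obtain rfl : j = 1 := by omega
        rw [hV1]
        push_cast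
        have e1 : |∑ i ∈ Finset.Icc 1 m, (a n i : ℝ) * (V n i : ℝ)|
            ≤ ∑ i ∈ Finset.Icc 1 m, (r - 1) * (B * r ^ n * (r⁻¹) ^ i) := by
          refine (Finset.abs_sum_le_sum_abs _ _).trans (Finset.sum_le_sum fun i hi => ?_)
          rw [abs_mul]
          have h1 : |(a n i : ℝ)| ≤ r - 1 := by
            have := ((hrun n).1 i hi).2.1
            have h2 : ((|a n i| : ℚ) : ℝ) < ((p / 2 : ℚ) : ℝ) := by exact_mod_cast this
            push_cast at h2
            rw [hr]; linarith
          rw [Finset.mem_Icc] at hi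
          have h2 := ih i (by simp; omega)
          gcongr
        have e2 := ih (m + 1) (by simp)
        have e3 : ∑ i ∈ Finset.Icc 1 m, (r - 1) * (B * r ^ n * (r⁻¹) ^ i)
            = B * r ^ n * (1 - (r⁻¹) ^ m) := by
          rw [← geom_q r hr0.ne', Finset.mul_sum, Finset.mul_sum]
          exact Finset.sum_congr rfl fun i _ => by ring
        have e4 : (r⁻¹) ^ (m + 1) ≤ (r⁻¹) ^ m :=
          pow_le_pow_of_le_one (by positivity) (inv_le_one_of_one_le₀ hr1.le) (by omega)
        have e5 : B * r ^ n * (r⁻¹) ^ (m + 1) ≤ B * r ^ n * (r⁻¹) ^ m := by gcongr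
        calc _ ≤ _ := abs_add_le _ _
          _ ≤ B * r ^ n * (1 - (r⁻¹) ^ m) + B * r ^ n * (r⁻¹) ^ m := by linarith
          _ = _ := by rw [pow_succ]; field_simp; ring
  -- p-adic bound
  obtain ⟨C, hC0, hC⟩ := exists_bound (Finset.Icc 1 (m + 1))
    (fun j => ‖(V n₀ j : ℚ_[p])‖ * (p : ℝ) ^ n₀)
  have hpad : ∀ n ≥ n₀, ∀ j ∈ Finset.Icc 1 (m + 1),
      ‖(V n j : ℚ_[p])‖ * (p : ℝ) ^ n ≤ C * (p : ℝ) ^ j := by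
    intro n hn
    induction n, hn using Nat.le_induction with
    | base =>
      intro j hj
      refine (hC j hj).trans (le_mul_of_one_le_right hC0.le (one_le_pow₀ (by linarith)))
    | succ n hn ih =>
      have key : ∀ j ∈ Finset.Icc 2 (m + 1),
          ‖(V (n + 1) j : ℚ_[p])‖ * (p : ℝ) ^ (n + 1) ≤ C * (p : ℝ) ^ j := by
        intro j hj
        rw [Finset.mem_Icc] at hj
        obtain ⟨j, rfl⟩ : ∃ k, j = k + 1 := ⟨j - 1, by omega⟩
        rw [hVs _ _ (by omega), pow_succ, pow_succ, ← mul_assoc, ← mul_assoc]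
        have := ih j (by simp; omega)
        gcongr
      intro j hj
      rcases Nat.lt_or_ge 1 j with h | h
      · rw [Finset.mem_Icc] at hj
        exact key j (by simp; omega)
      have hj1 : j = 1 := by rw [Finset.mem_Icc] at hj; omega
      subst hj1
      obtain ⟨g1, g2, g3⟩ := alpha_bound p m hm α a hrun n (hval (n + 1) (by omega))
      have hg0 : 0 < ‖α (n + 1) 1‖ := by linarith
      have hre := hrel (n + 1)
      rw [sum_Icc_shift _ hm, add_assoc] at hre
      have hre2 := eq_neg_of_add_eq_zero_left hre
      have hnorm : ‖(V (n + 1) 1 : ℚ_[p])‖ * ‖α (n + 1) 1‖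
          = ‖(∑ i ∈ Finset.Icc 2 m, (V (n + 1) i : ℚ_[p]) * α (n + 1) i)
            + (V (n + 1) (m + 1) : ℚ_[p])‖ := by
        rw [← norm_mul, hre2, norm_neg]
      obtain ⟨M, hM⟩ : ∃ M : ℝ, M = ‖α (n + 1) 1‖ * (C * (p : ℝ) ^ 1 / (p : ℝ) ^ (n + 1)) :=
        ⟨_, rfl⟩
      have hM0 : 0 ≤ M := by rw [hM]; positivity
      have t2 : ‖(V (n + 1) (m + 1) : ℚ_[p])‖ ≤ M := by
        have := key (m + 1) (by simp; omega)
        rw [hM, ← mul_div_assoc, le_div_iff₀ (by positivity)]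
        refine this.trans ?_
        calc C * (p : ℝ) ^ (m + 1) = (p : ℝ) ^ m * (C * (p : ℝ) ^ 1) := by ring
          _ ≤ _ := by gcongr
      have t1 : ‖∑ i ∈ Finset.Icc 2 m, (V (n + 1) i : ℚ_[p]) * α (n + 1) i‖ ≤ M := by
        refine IsUltrametricDist.norm_sum_le_of_forall_le_of_nonneg hM0 fun i hi => ?_
        have k2 := g3 i hi
        rw [Finset.mem_Icc] at hi
        have k1 := key i (by simp; omega)
        obtain ⟨i, rfl⟩ : ∃ k, i = k + 1 := ⟨i - 1, by omega⟩
        rw [Nat.add_sub_cancel] at k2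
        rw [norm_mul, hM, ← mul_div_assoc, le_div_iff₀ (by positivity)]
        calc _ = ‖(V (n + 1) (i + 1) : ℚ_[p])‖ * (p : ℝ) ^ (n + 1) * ‖α (n + 1) (i + 1)‖ := by ring
          _ ≤ C * (p : ℝ) ^ (i + 1) * ‖α (n + 1) (i + 1)‖ := by gcongr
          _ = (‖α (n + 1) (i + 1)‖ * (p : ℝ) ^ i) * (C * (p : ℝ) ^ 1) := by ring
          _ ≤ _ := by gcongr
      have t3 := (IsUltrametricDist.norm_add_le_max _ _).trans (max_le t1 t2)
      rw [← hnorm, hM, mul_comm] at t3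
      have t4 := le_of_mul_le_mul_left t3 hg0
      rwa [le_div_iff₀ (by positivity)] at t4
  -- eventual vanishing
  have hlim : Filter.Tendsto (fun n : ℕ => B * (C * (p : ℝ) ^ (m + 1)) * (r / p) ^ n)
      Filter.atTop (nhds 0) := by
    have := (tendsto_pow_atTop_nhds_zero_of_lt_one (r := r / p) (by positivity)
      ((div_lt_one hp0).2 hrp)).const_mul (B * (C * (p : ℝ) ^ (m + 1)))
    simpa using this
  obtain ⟨N, hN⟩ := ((hlim.eventually (gt_mem_nhds one_pos)).and
    (Filter.eventually_ge_atTop n₀)).exists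
  obtain ⟨hN1, hN2⟩ := hN
  have hzero : ∀ j ∈ Finset.Icc 1 (m + 1), V N j = 0 := by
    intro j hj
    by_contra hne
    have b1 := inZ_bound (hint N j hj) hne
    have b2 := harch N j hj
    have b3 := hpad N hN2 j hj
    rw [Finset.mem_Icc] at hj
    have b4 : |(V N j : ℝ)| ≤ B * r ^ N := b2.trans
      (mul_le_of_le_one_right (by positivity)
        (pow_le_one₀ (by positivity) (inv_le_one_of_one_le₀ hr1.le)))
    have b5 : ‖(V N j : ℚ_[p])‖ ≤ C * (p : ℝ) ^ (m + 1) / (p : ℝ) ^ N := by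
      rw [le_div_iff₀ (by positivity)]
      refine b3.trans ?_
      gcongr
      · linarith
      · exact hj.2
    have : |(V N j : ℝ)| * ‖(V N j : ℚ_[p])‖
        ≤ (B * r ^ N) * (C * (p : ℝ) ^ (m + 1) / (p : ℝ) ^ N) := by gcongr
    have e : (B * r ^ N) * (C * (p : ℝ) ^ (m + 1) / (p : ℝ) ^ N)
      = B * (C * (p : ℝ) ^ (m + 1)) * (r / p) ^ N := by rw [div_pow]; ring
    linarith
  -- descend
  have hdesc : ∀ n, (∀ j ∈ Finset.Icc 1 (m + 1), V n j = 0) →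
      ∀ j ∈ Finset.Icc 1 (m + 1), V 0 j = 0 := by
    intro n
    induction n with
    | zero => exact id
    | succ n ih =>
      intro h
      apply ih
      have hlow : ∀ j ∈ Finset.Icc 1 m, V n j = 0 := by
        intro j hj
        rw [Finset.mem_Icc] at hj
        rw [← hVs n j hj.1]
        exact h _ (by simp; omega)
      intro j hj
      rw [Finset.mem_Icc] at hj
      rcases Nat.lt_or_ge m j with h' | h'
      · obtain rfl : j = m + 1 := by omega
        have h1 := hV1 n
        rw [h 1 (by simp), Finset.sum_eq_zero fun i hi => by rw [hlow i hi, mul_zero]] at h1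
        simpa using h1.symm
      · exact hlow j (by simp; omega)
  exact hxi (hdesc N hzero i₀ hi₀)
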